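/- arXiv:2409.02956 — 2 statements merged into one kernel-verified Lean document; each statement's English description precedes it below -/
import Mathlib

section
/- Let D ⊂ ℝⁿ, n ≥ 2, be a bounded domain (nonempty open connected set), let f : D → ℝⁿ be a continuous, open, discrete mapping, let x₀ ∈ D, and let β : [0, 1] → ℝⁿ be a continuous path with β(0) = f(x₀) whose image β([0,1]) is disjoint from the cluster set C(f, ∂D). Then β has a complete f-lifting starting at x₀: there exists a continuous path α : [0, 1] → D with α(0) = x₀ and f ∘ α = β on [0, 1]. -/
open Set Filter Topology

/-- The cluster set `C(f, ∂D)` of `f : D → ℝⁿ` on the boundary of `D`: the set of all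
`y ∈ ℝⁿ` for which there exist a boundary point `x ∈ ∂D` and a sequence `x_k ∈ D` with
`x_k → x` and `f(x_k) → y`. -/
def clusterSetBoundary {n : ℕ} (f : EuclideanSpace ℝ (Fin n) → EuclideanSpace ℝ (Fin n))
    (D : Set (EuclideanSpace ℝ (Fin n))) : Set (EuclideanSpace ℝ (Fin n)) :=
  {y | ∃ x ∈ frontier D, ∃ u : ℕ → EuclideanSpace ℝ (Fin n),
    (∀ k, u k ∈ D) ∧ Tendsto u atTop (𝓝 x) ∧ Tendsto (fun k => f (u k)) atTop (𝓝 y)}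

/-- `QuasiLinked p x y` says that `y` lies in the quasi-component of `x` in the part of `K` lying
over the order interval `[p x, p y]`. -/
def QuasiLinked {K I : Type*} [TopologicalSpace K] [Preorder I] (p : K → I) (x y : K) : Prop :=
  ∀ U V : Set K, IsOpen U → IsOpen V → Disjoint U V → p ⁻¹' Icc (p x) (p y) ⊆ U ∪ V →
    x ∈ U → y ∈ U

namespace QuasiLinked

variable {K I : Type*} [TopologicalSpace K] {p : K → I}

lemma refl [Preorder I] (p : K → I) (x : K) : QuasiLinked p x x :=
  fun _ _ _ _ _ _ hx => hx

lemma trans [Preorder I] {x y z : K} (hxy : p x ≤ p y) (hyz : p y ≤ p z)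
    (h₁ : QuasiLinked p x y) (h₂ : QuasiLinked p y z) : QuasiLinked p x z :=
  fun U V hU hV hd hc hx =>
    h₂ U V hU hV hd ((preimage_mono (Icc_subset_Icc_left hxy)).trans hc)
      (h₁ U V hU hV hd ((preimage_mono (Icc_subset_Icc_right hyz)).trans hc) hx)

variable [ConditionallyCompleteLinearOrder I] [DenselyOrdered I] [TopologicalSpace I]
  [OrderTopology I] [CompactSpace K]

/-- An open map with finite fibres on a compact space has a linked point over every later time. -/
lemma exists_of_le (hp : Continuous p) (hopen : IsOpenMap p) (hfin : ∀ t, (p ⁻¹' {t}).Finite)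
    {x : K} {t : I} (hxt : p x ≤ t) : ∃ y, p y = t ∧ QuasiLinked p x y := by
  by_contra! hcon
  have hsep : ∀ y ∈ p ⁻¹' {t}, ∃ U V : Set K, IsOpen U ∧ IsOpen V ∧ Disjoint U V ∧
      p ⁻¹' Icc (p x) t ⊆ U ∪ V ∧ x ∈ U ∧ y ∉ U := by
    rintro y rfl
    have := hcon y rfl
    unfold QuasiLinked at this
    push Not at this
    obtain ⟨U, V, h1, h2, h3, h4, h5, h6⟩ := this
    exact ⟨U, V, h1, h2, h3, h4, h5, h6⟩
  choose! U V hU hV hd hc hx hy using hsep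
  set A : Set K := ⋂ y ∈ p ⁻¹' {t}, U y
  set B : Set K := ⋃ y ∈ p ⁻¹' {t}, V y
  have hA : IsOpen A := (hfin t).isOpen_biInter hU
  have hB : IsOpen B := isOpen_biUnion hV
  have hxA : x ∈ A := mem_iInter₂.2 hx
  have hAB : ∀ z ∈ A, z ∉ B := by
    intro z hzA hzB
    obtain ⟨y, hyt, hz⟩ := mem_iUnion₂.1 hzB
    exact (hd y hyt).notMem_of_mem_left (mem_iInter₂.1 hzA y hyt) hz
  have hcov : p ⁻¹' Icc (p x) t \ B ⊆ A := by
    rintro z ⟨hz, hzB⟩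
    refine mem_iInter₂.2 fun y hyt => (hc y hyt hz).resolve_right fun hzV => hzB ?_
    exact mem_iUnion₂.2 ⟨y, hyt, hzV⟩
  have hclosed : IsClosed (p '' (p ⁻¹' Icc (p x) t \ B)) :=
    (((isClosed_Icc.preimage hp).sdiff hB).isCompact.image hp).isClosed
  obtain ⟨r, hr, ⟨z, hzA, rfl⟩, hrn⟩ := (isPreconnected_Icc (a := p x) (b := t))
    (p '' A) (p '' (p ⁻¹' Icc (p x) t \ B))ᶜ (hopen A hA) hclosed.isOpen_compl
    (fun r _ => or_iff_not_imp_left.2 fun h h' => h (image_mono hcov h'))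
    ⟨p x, left_mem_Icc.2 hxt, mem_image_of_mem p hxA⟩
    ⟨t, right_mem_Icc.2 hxt, by
      rintro ⟨y, hyB, hyt⟩
      exact hy y hyt (mem_iInter₂.1 (hcov hyB) y hyt)⟩
  exact hrn (mem_image_of_mem p ⟨hr, hAB z hzA⟩)

lemma exists_finset_section (hp : Continuous p) (hopen : IsOpenMap p)
    (hfin : ∀ t, (p ⁻¹' {t}).Finite) (x₀ : K) (hx₀ : ∀ t, p x₀ ≤ t) (F : Finset I) :
    ∃ α : I → K, (∀ t ∈ F, p (α t) = t ∧ QuasiLinked p x₀ (α t)) ∧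
      ∀ s ∈ F, ∀ t ∈ F, s ≤ t → QuasiLinked p (α s) (α t) := by
  classical
  induction F using Finset.induction_on_max with
  | empty => exact ⟨fun _ => x₀, by simp, by simp⟩
  | insert a F ha ih =>
    obtain ⟨α, h₁, h₂⟩ := ih
    obtain ⟨y, hya, hy₀, hy⟩ : ∃ y, p y = a ∧ QuasiLinked p x₀ y ∧
        ∀ s ∈ F, QuasiLinked p (α s) y := by
      rcases F.eq_empty_or_nonempty with rfl | hF
      · obtain ⟨y, hya, hy⟩ := exists_of_le hp hopen hfin (hx₀ a)
        exact ⟨y, hya, hy, by simp⟩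
      · set m := F.max' hF
        have hm : m ∈ F := F.max'_mem hF
        have hle : p (α m) ≤ a := (h₁ m hm).1.trans_le (ha m hm).le
        obtain ⟨y, rfl, hy⟩ := exists_of_le hp hopen hfin hle
        refine ⟨y, rfl, trans (hx₀ _) hle (h₁ m hm).2 hy, fun s hs => ?_⟩
        refine trans ?_ hle (h₂ s hs m hm (F.le_max' s hs)) hy
        rw [(h₁ s hs).1, (h₁ m hm).1]
        exact F.le_max' s hs
    have hne : ∀ s ∈ F, s ≠ a := fun s hs => (ha s hs).ne
    refine ⟨Function.update α a y, fun t ht => ?_, fun s hs t ht hst => ?_⟩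
    · rcases Finset.mem_insert.1 ht with rfl | ht
      · simpa using ⟨hya, hy₀⟩
      · simpa [hne t ht] using h₁ t ht
    · rcases Finset.mem_insert.1 hs with rfl | hs' <;> rcases Finset.mem_insert.1 ht with rfl | ht'
      · exact refl p _
      · exact absurd hst (ha t ht').not_ge
      · simpa [hne s hs'] using hy s hs'
      · simpa [hne s hs', hne t ht'] using h₂ s hs' t ht' hst

/-- Compactness of the product of the finite fibres yields a section all of whose values are
linked. -/
lemma exists_section (hp : Continuous p) (hopen : IsOpenMap p)
    (hfin : ∀ t, (p ⁻¹' {t}).Finite) (x₀ : K) (hx₀ : ∀ t, p x₀ ≤ t) :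
    ∃ α : I → K, (∀ t, p (α t) = t ∧ QuasiLinked p x₀ (α t)) ∧
      ∀ s t, s ≤ t → QuasiLinked p (α s) (α t) := by
  choose α h₁ h₂ using exists_finset_section hp hopen hfin x₀ hx₀
  let G : Ultrafilter (Finset I) := Ultrafilter.of atTop
  have hG : ∀ t : I, ∀ᶠ F in (G : Filter (Finset I)), t ∈ F := fun t =>
    Ultrafilter.of_le atTop ((eventually_ge_atTop {t}).mono fun F hF => hF (by simp))
  have hval : ∀ t, ∃ y, ∀ᶠ F in (G : Filter (Finset I)), α F t = y := by
    intro t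
    have hmem : (⋃ y ∈ p ⁻¹' {t}, {F | α F t = y}) ∈ G := by
      filter_upwards [hG t] with F hF
      simpa using (h₁ F t hF).1
    obtain ⟨y, -, hy⟩ := (Ultrafilter.finite_biUnion_mem_iff (hfin t)).1 hmem
    exact ⟨y, hy⟩
  choose γ hγ using hval
  refine ⟨γ, fun t => ?_, fun s t hst => ?_⟩
  · obtain ⟨F, hF, hFt⟩ := ((hγ t).and (hG t)).exists
    exact hF ▸ h₁ F t hFt
  · obtain ⟨F, ⟨hs, hFs⟩, ht, hFt⟩ := (((hγ s).and (hG s)).and ((hγ t).and (hG t))).exists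
    exact hs ▸ ht ▸ h₂ F s hFs t hFt hst

end QuasiLinked

/-- A point of a finite set in a Hausdorff space is separated, within any neighbourhood, from the
other points of the set. -/
lemma Set.Finite.exists_isOpen_disjoint_cover {X : Type*} [TopologicalSpace X] [T2Space X]
    {S W : Set X} (hS : S.Finite) {x : X} (hW : W ∈ 𝓝 x) :
    ∃ U V : Set X, IsOpen U ∧ IsOpen V ∧ Disjoint U V ∧ x ∈ U ∧ U ⊆ W ∧ S ⊆ U ∪ V := by
  obtain ⟨U, V, hU, hV, hxU, hSV, hd⟩ :=
    SeparatedNhds.of_isCompact_isCompact (isCompact_singleton (x := x))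
      (hS.subset (sdiff_subset (t := {x}))).isCompact (disjoint_sdiff_right)
  obtain ⟨W', hW', hW'o, hxW'⟩ := mem_nhds_iff.1 hW
  refine ⟨U ∩ W', V, hU.inter hW'o, hV, hd.mono_left inter_subset_left,
    ⟨hxU rfl, hxW'⟩, inter_subset_right.trans hW', fun z hz => ?_⟩
  by_cases hzx : z = x
  · exact Or.inl (hzx ▸ ⟨hxU rfl, hxW'⟩)
  · exact Or.inr (hSV ⟨hz, hzx⟩)

/-- An open continuous map with finite fibres from a compact Hausdorff space to a linear continuum
has a continuous section through every point lying over the least element. -/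
theorem IsOpenMap.exists_continuous_section {K I : Type*} [TopologicalSpace K] [CompactSpace K]
    [T2Space K] [ConditionallyCompleteLinearOrder I] [DenselyOrdered I] [TopologicalSpace I]
    [OrderTopology I] {p : K → I} (hopen : IsOpenMap p) (hp : Continuous p)
    (hfin : ∀ t, (p ⁻¹' {t}).Finite) (x₀ : K) (hx₀ : ∀ t, p x₀ ≤ t) :
    ∃ α : I → K, Continuous α ∧ α (p x₀) = x₀ ∧ ∀ t, p (α t) = t := by
  obtain ⟨α, h₁, h₂⟩ := QuasiLinked.exists_section hp hopen hfin x₀ hx₀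
  refine ⟨α, continuous_iff_continuousAt.2 fun s W hW => ?_, ?_, fun t => (h₁ t).1⟩
  · rw [mem_map]
    obtain ⟨U, V, hU, hV, hd, hxU, hUW, hc⟩ := (hfin s).exists_isOpen_disjoint_cover hW
    have hN : ∀ᶠ r in 𝓝 s, p ⁻¹' {r} ⊆ U ∪ V :=
      hp.isClosedMap.eventually_nhds_fiber s fun z hz => (hU.union hV).mem_nhds (hc hz)
    have hN' : ∀ᶠ t in 𝓝 s, ∀ r ∈ uIcc s t, p ⁻¹' {r} ⊆ U ∪ V :=
      (tendsto_const_nhds.uIcc tendsto_id).eventually hN.smallSets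
    filter_upwards [hN'] with t ht
    refine hUW ?_
    rcases le_total s t with hst | hts
    · refine h₂ s t hst U V hU hV hd (fun z hz => ?_) hxU
      rw [(h₁ s).1, (h₁ t).1] at hz
      exact ht (p z) (uIcc_of_le hst ▸ hz) rfl
    · refine (ht t right_mem_uIcc (h₁ t).1).resolve_right fun htV => ?_
      refine hd.notMem_of_mem_left hxU (h₂ t s hts V U hV hU hd.symm (fun z hz => ?_) htV)
      rw [(h₁ s).1, (h₁ t).1] at hz
      exact (ht (p z) (uIcc_of_ge hts ▸ hz) rfl).symm
  · by_contra hne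
    obtain ⟨U, V, hU, hV, hd, hxU, hUW, hc⟩ := (hfin (p x₀)).exists_isOpen_disjoint_cover
      (isOpen_ne.mem_nhds (Ne.symm hne))
    refine hUW ((h₁ (p x₀)).2 U V hU hV hd ?_ hxU) rfl
    rwa [(h₁ (p x₀)).1, Icc_self]

/-- The part of the graph of `t ↦ f ⁻¹' {β t}` over `[0,1]` is compact when `β` avoids the boundary
cluster set. -/
lemma isCompact_setOf_eq_of_notMem_clusterSetBoundary {n : ℕ}
    {D : Set (EuclideanSpace ℝ (Fin n))} (hDopen : IsOpen D) (hDbd : Bornology.IsBounded D)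
    {f : EuclideanSpace ℝ (Fin n) → EuclideanSpace ℝ (Fin n)} (hf : ContinuousOn f D)
    {b : unitInterval → EuclideanSpace ℝ (Fin n)} (hb : Continuous b)
    (hb_avoid : ∀ t, b t ∉ clusterSetBoundary f D) :
    IsCompact {q : unitInterval × EuclideanSpace ℝ (Fin n) | q.2 ∈ D ∧ f q.2 = b q.1} := by
  refine (isCompact_univ.prod hDbd.isCompact_closure).of_isClosed_subset
    (IsSeqClosed.isClosed ?_) fun q hq => ⟨mem_univ _, subset_closure hq.1⟩
  intro u q hu hq
  have h1 : Tendsto (fun k => (u k).1) atTop (𝓝 q.1) := (continuous_fst.tendsto q).comp hq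
  have h2 : Tendsto (fun k => (u k).2) atTop (𝓝 q.2) := (continuous_snd.tendsto q).comp hq
  have h3 : Tendsto (fun k => f (u k).2) atTop (𝓝 (b q.1)) :=
    ((hb.tendsto q.1).comp h1).congr fun k => (hu k).2.symm
  have hqD : q.2 ∈ D := by
    by_contra hqD
    refine hb_avoid q.1 ⟨q.2, ?_, fun k => (u k).2, fun k => (hu k).1, h2, h3⟩
    rw [hDopen.frontier_eq]
    exact ⟨mem_closure_of_tendsto h2 (Eventually.of_forall fun k => (hu k).1), hqD⟩
  exact ⟨hqD, tendsto_nhds_unique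
    (((hf.continuousAt (hDopen.mem_nhds hqD)).tendsto).comp h2) h3⟩

/-- Let `D ⊂ ℝⁿ`, `n ≥ 2`, be a bounded domain, `f : D → ℝⁿ` a continuous,
open, discrete mapping, `x₀ ∈ D`, and `β : [0,1] → ℝⁿ` a continuous path with `β(0) = f(x₀)`
whose image avoids the cluster set `C(f, ∂D)`. Then `β` has a complete `f`-lifting starting
at `x₀`: a continuous `α : [0,1] → D` with `α(0) = x₀` and `f ∘ α = β` on `[0,1]`. -/
theorem statement1 {n : ℕ} (hn : 2 ≤ n) (D : Set (EuclideanSpace ℝ (Fin n)))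
    (hDopen : IsOpen D) (hDconn : IsConnected D) (hDbd : Bornology.IsBounded D)
    (f : EuclideanSpace ℝ (Fin n) → EuclideanSpace ℝ (Fin n))
    (hf_cont : ContinuousOn f D)
    (hf_open : ∀ U ⊆ D, IsOpen U → IsOpen (f '' U))
    (hf_disc : ∀ z : EuclideanSpace ℝ (Fin n), ∀ x ∈ D,
      ¬ AccPt x (Filter.principal (D ∩ f ⁻¹' {z})))
    (x₀ : EuclideanSpace ℝ (Fin n)) (hx₀ : x₀ ∈ D)
    (β : ℝ → EuclideanSpace ℝ (Fin n)) (hβ_cont : ContinuousOn β (Icc 0 1))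
    (hβ₀ : β 0 = f x₀)
    (hβ_avoid : ∀ t ∈ Icc (0:ℝ) 1, β t ∉ clusterSetBoundary f D) :
    ∃ α : ℝ → EuclideanSpace ℝ (Fin n),
      ContinuousOn α (Icc 0 1) ∧ α 0 = x₀ ∧
        ∀ t ∈ Icc (0:ℝ) 1, α t ∈ D ∧ f (α t) = β t := by
  set b : unitInterval → EuclideanSpace ℝ (Fin n) := fun t => β t
  have hb : Continuous b := hβ_cont.domRestrict
  set S : Set (unitInterval × EuclideanSpace ℝ (Fin n)) := {q | q.2 ∈ D ∧ f q.2 = b q.1}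
  have hS : IsCompact S := isCompact_setOf_eq_of_notMem_clusterSetBoundary hDopen hDbd hf_cont hb
    fun t => hβ_avoid t t.2
  have : CompactSpace S := isCompact_iff_compactSpace.1 hS
  let p : S → unitInterval := fun q => q.1.1
  have hp : Continuous p := by fun_prop
  have hopen : IsOpenMap p := by
    rw [isOpenMap_iff_nhds_le]
    rintro ⟨⟨t, x⟩, hxD, hfx⟩ N hN
    obtain ⟨O, hO, hON⟩ := (mem_nhds_subtype _ _ _).1 hN
    obtain ⟨T, hT, W, hW, hTW⟩ := mem_nhds_prod_iff.1 hO
    obtain ⟨W', hW', hW'o, hxW'⟩ := mem_nhds_iff.1 (inter_mem hW (hDopen.mem_nhds hxD))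
    have himg : f '' W' ∈ 𝓝 (b t) :=
      (hf_open W' (hW'.trans inter_subset_right) hW'o).mem_nhds ⟨x, hxW', hfx⟩
    filter_upwards [hT, hb.continuousAt himg] with s hs ⟨z, hz, hzs⟩
    have hmem : (⟨(s, z), (hW' hz).2, hzs⟩ : S) ∈ p ⁻¹' N :=
      hON (hTW ⟨hs, (hW' hz).1⟩)
    exact hmem
  have hfin : ∀ t, (p ⁻¹' {t}).Finite := by
    intro t
    have hinj : InjOn (fun q : S => q.1.2) (p ⁻¹' {t}) := fun q hq r hr h =>
      Subtype.ext (Prod.ext (hq.trans hr.symm) h)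
    refine Finite.of_finite_image (by_contra fun hinf => ?_) hinj
    have hcomp : IsCompact ((fun q : S => q.1.2) '' (p ⁻¹' {t})) :=
      ((isClosed_singleton.preimage hp).isCompact).image (by fun_prop)
    obtain ⟨x, ⟨q, -, rfl⟩, hacc⟩ :=
      Set.Infinite.exists_accPt_of_subset_isCompact hinf hcomp Subset.rfl
    refine hf_disc (b t) q.1.2 q.2.1 (hacc.mono (principal_mono.2 ?_))
    rintro _ ⟨r, rfl, rfl⟩
    exact r.2
  obtain ⟨α, hα, hα₀, hαp⟩ := hopen.exists_continuous_section hp hfin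
    ⟨(0, x₀), hx₀, hβ₀.symm⟩ fun t => t.2.1
  refine ⟨fun t => (α (projIcc 0 1 zero_le_one t)).1.2, ?_, ?_, fun t ht => ?_⟩
  · exact (continuous_snd.comp (continuous_subtype_val.comp
      (hα.comp continuous_projIcc))).continuousOn
  · have h0 : projIcc (0 : ℝ) 1 zero_le_one 0 = (0 : unitInterval) := projIcc_left _
    simp only [h0]
    exact congrArg (fun q : S => q.1.2) hα₀
  · simp only [projIcc_of_mem zero_le_one ht]
    refine ⟨(α ⟨t, ht⟩).2.1, (α ⟨t, ht⟩).2.2.trans ?_⟩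
    exact congrArg b (hαp ⟨t, ht⟩)
end

section
/- Let n ≥ 2, let z₀ ∈ ℝⁿ, let 0 < r₁ < r₂, and let Q̃ : ℝⁿ → [1, ∞] be a Borel measurable function. Define q̃_{z₀}(r) = (1/(ω_{n−1} r^{n−1})) ∫_{S(z₀, r)} Q̃ dH^{n−1} and I = ∫_{r₁}^{r₂} dt / ( t · q̃_{z₀}(t)^{1/(n−1)} ), and suppose 0 < I < ∞. Put η₀(t) = 1 / ( I · t · q̃_{z₀}(t)^{1/(n−1)} ) for t ∈ (r₁, r₂). Then ∫_{r₁}^{r₂} η₀(t) dt = 1 and ∫_{A(z₀, r₁, r₂)} Q̃(y) · η₀(|y − z₀|)ⁿ dm(y) ≤ ω_{n−1} / I^{n−1}. -/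
open Set Filter Topology MeasureTheory
open scoped Pointwise

/-- The part of the cone over `B ⊆ ℝᵈ` (placed at height one) of height less than one
has volume `vol B / (d + 1)`. -/
theorem succ_mul_volume_truncatedCone {d : ℕ} {B : Set (Fin d → ℝ)} (hB : MeasurableSet B) :
    (d + 1 : ENNReal) * volume {x : EuclideanSpace ℝ (Fin (d + 1)) |
      x 0 ∈ Ioo (0 : ℝ) 1 ∧ (fun i : Fin d => (x 0)⁻¹ * x i.succ) ∈ B} = volume B := by
  set C : Set (ℝ × (Fin d → ℝ)) := {p | p.1 ∈ Ioo (0 : ℝ) 1 ∧ p.1⁻¹ • p.2 ∈ B} with hC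
  have hCm : MeasurableSet C := by
    refine (measurableSet_Ioo.preimage measurable_fst).inter (hB.preimage ?_)
    fun_prop
  have hpre : {x : EuclideanSpace ℝ (Fin (d + 1)) |
      x 0 ∈ Ioo (0 : ℝ) 1 ∧ (fun i : Fin d => (x 0)⁻¹ * x i.succ) ∈ B} =
      (MeasurableEquiv.piFinSuccAbove (fun _ : Fin (d + 1) => ℝ) 0 ∘ WithLp.ofLp) ⁻¹' C := by
    ext x
    rfl
  have hmp := (volume_preserving_piFinSuccAbove (fun _ : Fin (d + 1) => ℝ) 0).comp
    (PiLp.volume_preserving_ofLp (Fin (d + 1)))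
  have hslice (t : ℝ) : volume (Prod.mk t ⁻¹' C) =
      (Ioo (0 : ℝ) 1).indicator (fun t => ENNReal.ofReal (t ^ d) * volume B) t := by
    by_cases ht : t ∈ Ioo (0 : ℝ) 1
    · rw [indicator_of_mem ht]
      have : Prod.mk t ⁻¹' C = (fun v : Fin d → ℝ => t⁻¹ • v) ⁻¹' B := by
        ext v
        exact and_iff_right ht
      rw [this, Measure.addHaar_preimage_smul _ (inv_ne_zero ht.1.ne')]
      simp [abs_of_pos ht.1]
    · rw [indicator_of_notMem ht]
      have : Prod.mk t ⁻¹' C = ∅ := by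
        ext v
        exact iff_of_false (fun h => ht h.1) (notMem_empty v)
      simp [this]
  have hint : ∫⁻ t in Ioo (0 : ℝ) 1, ENNReal.ofReal (t ^ d) = ENNReal.ofReal (1 / (d + 1)) := by
    rw [Measure.restrict_congr_set Ioo_ae_eq_Ioc,
      ← ofReal_integral_eq_lintegral_ofReal (intervalIntegral.intervalIntegrable_pow _).1,
      ← intervalIntegral.integral_of_le zero_le_one]
    · simp
    · filter_upwards [ae_restrict_mem measurableSet_Ioc] with y hy
      exact pow_nonneg hy.1.le _
  rw [hpre, hmp.measure_preimage hCm.nullMeasurableSet, Measure.volume_eq_prod,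
    Measure.prod_apply hCm]
  simp_rw [hslice]
  rw [lintegral_indicator measurableSet_Ioo, lintegral_mul_const _ (by fun_prop), hint, ← mul_assoc]
  have : (d + 1 : ENNReal) = ENNReal.ofReal (d + 1) := by
    rw [ENNReal.ofReal_add (by positivity) zero_le_one]
    simp
  rw [this, ← ENNReal.ofReal_mul (by positivity), mul_one_div_cancel (by positivity)]
  simp

theorem exists_linearIsometryEquiv_apply_eq_single {d : ℕ}
    (p : EuclideanSpace ℝ (Fin (d + 1))) (hp : ‖p‖ = 1) :
    ∃ L : EuclideanSpace ℝ (Fin (d + 1)) ≃ₗᵢ[ℝ] EuclideanSpace ℝ (Fin (d + 1)),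
      L p = EuclideanSpace.single 0 1 := by
  have hv : Orthonormal ℝ (({0} : Set (Fin (d + 1))).domRestrict fun _ => p) := by
    refine ⟨fun i => hp, fun i j hij => (hij (Subsingleton.elim i j)).elim⟩
  obtain ⟨b, hb⟩ := hv.exists_orthonormalBasis_extension_of_card_eq (by simp)
  refine ⟨b.repr, ?_⟩
  rw [← hb 0 rfl, b.repr_self]

/-- Central projection from a small spherical cap near the pole is almost `1`-Lipschitz
in each coordinate. -/
theorem abs_inv_mul_sub_inv_mul_le {δ D a b u v : ℝ} (hδ : 0 < δ) (hδ1 : δ < 1)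
    (ha : 1 - δ ≤ a) (hb : 1 - δ ≤ b) (hb1 : b ≤ 1) (hv : |v| ≤ δ)
    (huv : |u - v| ≤ D) (hab : |a - b| ≤ D) :
    |a⁻¹ * u - b⁻¹ * v| ≤ (1 + δ) / (1 - δ) ^ 2 * D := by
  have ha0 : 0 < a := by linarith
  have hb0 : 0 < b := by linarith
  have hD : 0 ≤ D := (abs_nonneg _).trans huv
  have h1 : a⁻¹ * u - b⁻¹ * v = ((u - v) * b - v * (a - b)) / (a * b) := by
    field_simp
    ring
  have h2 : |(u - v) * b - v * (a - b)| ≤ D * 1 + δ * D := by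
    refine (abs_sub _ _).trans ?_
    rw [abs_mul, abs_mul, abs_of_pos hb0]
    gcongr
  rw [h1, abs_div, abs_of_pos (mul_pos ha0 hb0), div_mul_eq_mul_div]
  have h3 : 0 < 1 - δ := by linarith
  have h4 : (1 - δ) ^ 2 ≤ a * b := by
    rw [sq]
    gcongr
  gcongr
  linarith

theorem toSphere_le_of_ediam_le {d : ℕ} {δ : ℝ} (hδ : 0 < δ) (hδ1 : δ < 1)
    (s : Set (Metric.sphere (0 : EuclideanSpace ℝ (Fin (d + 1))) 1))
    (hs : Metric.ediam s ≤ ENNReal.ofReal δ) :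
    (volume : Measure (EuclideanSpace ℝ (Fin (d + 1)))).toSphere s ≤
      (ENNReal.ofReal ((1 + δ) / (1 - δ) ^ 2) * Metric.ediam s) ^ d := by
  rcases s.eq_empty_or_nonempty with rfl | ⟨p, hp⟩
  · simp
  wlog hcl : IsClosed s generalizing s
  · have := this (closure s) (by rwa [Metric.ediam_closure]) (subset_closure hp) isClosed_closure
    rw [Metric.ediam_closure] at this
    exact (measure_mono subset_closure).trans this
  obtain ⟨L, hL⟩ := exists_linearIsometryEquiv_apply_eq_single p.1 (by simp)
  have hfin : Metric.ediam s ≠ ⊤ := ne_top_of_le_ne_top ENNReal.ofReal_ne_top hs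
  set D : ℝ := (Metric.ediam s).toReal with hD
  have hDδ : D ≤ δ := ENNReal.toReal_le_of_le_ofReal hδ.le hs
  have hdist {x y} (hx : x ∈ s) (hy : y ∈ s) (i : Fin (d + 1)) : |L x i - L y i| ≤ D := by
    have h1 : dist x y ≤ D := Metric.dist_le_diam_of_mem' hfin hx hy
    have h2 : ‖L x - L y‖ = dist x y := by
      rw [← map_sub, L.norm_map, Subtype.dist_eq, dist_eq_norm]
    have h3 := PiLp.norm_apply_le (L x - L y) i
    rw [h2] at h3
    exact h3.trans h1
  have hle (x : Metric.sphere (0 : EuclideanSpace ℝ (Fin (d + 1))) 1) : L x 0 ≤ 1 := by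
    have h3 := PiLp.norm_apply_le (L x) 0
    rw [L.norm_map] at h3
    exact (le_abs_self _).trans (h3.trans (by simp))
  have hge {x} (hx : x ∈ s) : 1 - δ ≤ L x 0 := by
    have := (abs_le.1 (hdist hx hp 0)).1
    rw [hL] at this
    simp at this
    linarith
  have hsmall {x} (hx : x ∈ s) (i : Fin d) : |L x i.succ| ≤ δ := by
    have := hdist hx hp i.succ
    rw [hL] at this
    simp at this
    linarith
  set g : Metric.sphere (0 : EuclideanSpace ℝ (Fin (d + 1))) 1 → Fin d → ℝ :=
    fun x i => (L x 0)⁻¹ * L x i.succ with hg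
  set K : ℝ := (1 + δ) / (1 - δ) ^ 2 with hK
  have hK0 : 0 ≤ K := by positivity
  have hgd : Metric.ediam (closure (g '' s)) ≤ ENNReal.ofReal K * Metric.ediam s := by
    rw [Metric.ediam_closure]
    refine Metric.ediam_le ?_
    rintro _ ⟨x, hx, rfl⟩ _ ⟨y, hy, rfl⟩
    rw [← ENNReal.ofReal_toReal hfin, ← ENNReal.ofReal_mul hK0, edist_dist]
    refine ENNReal.ofReal_le_ofReal ((dist_pi_le_iff (by positivity)).2 fun i => ?_)
    exact abs_inv_mul_sub_inv_mul_le hδ hδ1 (hge hx) (hge hy) (hle y) (hsmall hy i)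
      (hdist hx hy _) (hdist hx hy _)
  have hsub : Ioo (0 : ℝ) 1 • ((↑) '' s : Set (EuclideanSpace ℝ (Fin (d + 1)))) ⊆
      L ⁻¹' {x | x 0 ∈ Ioo (0 : ℝ) 1 ∧
        (fun i : Fin d => (x 0)⁻¹ * x i.succ) ∈ closure (g '' s)} := by
    rintro _ ⟨t, ht, _, ⟨x, hx, rfl⟩, rfl⟩
    have hx0 : 0 < L x 0 := by linarith [hge hx]
    refine ⟨?_, subset_closure ⟨x, hx, ?_⟩⟩
    · simp only [map_smul, PiLp.smul_apply, smul_eq_mul]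
      exact ⟨mul_pos ht.1 hx0, mul_lt_one_of_nonneg_of_lt_one_left ht.1.le ht.2 (hle x)⟩
    · ext i
      have := ht.1.ne'
      simp only [hg, map_smul, PiLp.smul_apply, smul_eq_mul]
      field_simp
  have hvol := (measure_mono (μ := volume) hsub).trans
    (L.measurePreserving.measure_preimage_emb L.toMeasurableEquiv.measurableEmbedding _).le
  rw [Measure.toSphere_apply' _ hcl.measurableSet, finrank_euclideanSpace_fin, Nat.cast_succ]
  refine (mul_le_mul_right hvol _).trans ?_
  rw [succ_mul_volume_truncatedCone isClosed_closure.measurableSet]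
  refine (Real.volume_pi_le_diam_pow _).trans ?_
  rw [Fintype.card_fin]
  gcongr

/-- With Mathlib's normalization of the Hausdorff measure, the surface measure on the unit sphere
is at most the Hausdorff measure. -/
theorem toSphere_le_hausdorffMeasure (d : ℕ) :
    (volume : Measure (EuclideanSpace ℝ (Fin (d + 1)))).toSphere ≤ μH[(d : ℝ)] := by
  have key {δ : ℝ} (hδ : 0 < δ) (hδ1 : δ < 1) :
      (volume : Measure (EuclideanSpace ℝ (Fin (d + 1)))).toSphere ≤
        ENNReal.ofReal ((1 + δ) / (1 - δ) ^ 2) ^ d • μH[(d : ℝ)] := by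
    set c := ENNReal.ofReal ((1 + δ) / (1 - δ) ^ 2) ^ d with hc
    have hpos : 0 < (1 + δ) / (1 - δ) ^ 2 := by
      have : 0 < 1 - δ := by linarith
      positivity
    have hc0 : c ≠ 0 := pow_ne_zero _ (ENNReal.ofReal_pos.2 hpos).ne'
    have hct : c ≠ ⊤ := ENNReal.pow_ne_top ENNReal.ofReal_ne_top
    have h : c⁻¹ • (volume : Measure (EuclideanSpace ℝ (Fin (d + 1)))).toSphere ≤ μH[(d : ℝ)] := by
      refine Measure.le_hausdorffMeasure _ _ (ENNReal.ofReal δ) (ENNReal.ofReal_pos.2 hδ) ?_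
      intro s hs
      have := toSphere_le_of_ediam_le hδ hδ1 s hs
      rw [mul_pow, ← hc] at this
      rw [Measure.smul_apply, smul_eq_mul, ENNReal.rpow_natCast]
      exact (ENNReal.inv_mul_le_iff hc0 hct).2 this
    refine Measure.le_iff'.2 fun s => ?_
    have := h s
    rw [Measure.smul_apply, smul_eq_mul] at this
    exact (ENNReal.inv_mul_le_iff hc0 hct).1 this
  refine Measure.le_iff'.2 fun s => ?_
  have hlim : Tendsto (fun δ : ℝ => ENNReal.ofReal ((1 + δ) / (1 - δ) ^ 2) ^ d * μH[(d : ℝ)] s)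
      (𝓝[>] 0) (𝓝 (1 * μH[(d : ℝ)] s)) := by
    refine ENNReal.Tendsto.mul_const ?_ (Or.inl one_ne_zero)
    have hr : ContinuousAt (fun δ : ℝ => (1 + δ) / (1 - δ) ^ 2) 0 := by
      refine ContinuousAt.div (by fun_prop) (by fun_prop) (by norm_num)
    have := ((ENNReal.continuous_pow d).tendsto _).comp
      ((ENNReal.continuous_ofReal.tendsto _).comp hr.tendsto)
    simp only [add_zero, sub_zero, one_pow, div_one, ENNReal.ofReal_one] at this
    exact this.mono_left nhdsWithin_le_nhds
  rw [one_mul] at hlim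
  refine ge_of_tendsto hlim ?_
  filter_upwards [Ioo_mem_nhdsGT (zero_lt_one' ℝ)] with δ hδ
  exact key hδ.1 hδ.2 s

/-- Integration in polar coordinates, as an inequality valid without measurability. -/
theorem lintegral_le_lintegral_toSphere {E : Type*} [NormedAddCommGroup E] [NormedSpace ℝ E]
    [MeasurableSpace E] [BorelSpace E] [FiniteDimensional ℝ E] [Nontrivial E]
    (μ : Measure E) [μ.IsAddHaarMeasure] (f : E → ENNReal) :
    ∫⁻ y, f y ∂μ ≤ ∫⁻ r in Ioi (0 : ℝ), ENNReal.ofReal (r ^ (Module.finrank ℝ E - 1)) *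
      ∫⁻ θ : Metric.sphere (0 : E) 1, f (r • (θ : E)) ∂μ.toSphere := by
  set N := Module.finrank ℝ E - 1
  calc ∫⁻ y, f y ∂μ = ∫⁻ y : ({0}ᶜ : Set E), f y ∂μ.comap (↑) := by
        rw [lintegral_subtype_comap (measurableSet_singleton _).compl, restrict_compl_singleton]
    _ = ∫⁻ p, f (p.2.1 • p.1.1) ∂μ.toSphere.prod (.volumeIoiPow N) := by
        rw [← μ.measurePreserving_homeomorphUnitSphereProd.lintegral_comp_emb
          (Homeomorph.measurableEmbedding _)]
        refine lintegral_congr fun y => ?_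
        rw [← homeomorphUnitSphereProd_symm_apply_coe, Homeomorph.symm_apply_apply]
    _ = ∫⁻ p, f (p.1.1 • p.2.1) ∂(Measure.volumeIoiPow N).prod μ.toSphere := by
        rw [← Measure.prod_swap]
        exact lintegral_map_equiv _ MeasurableEquiv.prodComm
    _ ≤ ∫⁻ r, ∫⁻ θ, f (r.1 • θ.1) ∂μ.toSphere ∂.volumeIoiPow N := lintegral_prod_le _
    _ = _ := by
        rw [Measure.volumeIoiPow, lintegral_withDensity_eq_lintegral_mul_non_measurable _
          (by fun_prop) (by simp), ← lintegral_subtype_comap measurableSet_Ioi]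
        rfl

theorem setLIntegral_sphere_hausdorffMeasure {E : Type*} [NormedAddCommGroup E] [NormedSpace ℝ E]
    [MeasurableSpace E] [BorelSpace E] (d : ℕ) (z : E) {r : ℝ} (hr : 0 < r)
    {Q : E → ENNReal} (hQ : Measurable Q) :
    ∫⁻ y in Metric.sphere z r, Q y ∂μH[(d : ℝ)] =
      ENNReal.ofReal (r ^ d) *
        ∫⁻ θ : Metric.sphere (0 : E) 1, Q (r • (θ : E) + z) ∂μH[(d : ℝ)] := by
  have hd : (0 : ℝ) ≤ d := d.cast_nonneg
  have hhom : Continuous (AffineMap.homothety z r) := AffineMap.homothety_continuous z r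
  have hmap : (μH[(d : ℝ)] : Measure E) =
      ENNReal.ofReal (r ^ d) • Measure.map (AffineMap.homothety z r) μH[(d : ℝ)] := by
    rw [map_homothety_hausdorffMeasure hd z hr.ne']
    ext s
    have hc : ENNReal.ofReal (r ^ d) = ((‖r‖₊ ^ d : NNReal) : ENNReal) := by
      rw [ENNReal.ofReal_pow hr.le, ← Real.enorm_of_nonneg hr.le]
      simp [enorm]
    have hr0 : ‖r‖₊ ^ d ≠ 0 := pow_ne_zero _ (nnnorm_ne_zero_iff.2 hr.ne')
    rw [Measure.smul_apply, Measure.smul_apply, smul_eq_mul, hc, ENNReal.smul_def, smul_eq_mul,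
      ← mul_assoc, ← ENNReal.coe_mul, NNReal.rpow_natCast, inv_pow, mul_inv_cancel₀ hr0,
      ENNReal.coe_one, one_mul]
  have hiso : Isometry fun θ : Metric.sphere (0 : E) 1 => (θ : E) + z :=
    (IsometryEquiv.addRight z).isometry.comp isometry_subtype_coe
  have hrange : range (fun θ : Metric.sphere (0 : E) 1 => (θ : E) + z) = Metric.sphere z 1 := by
    ext y
    constructor
    · rintro ⟨θ, rfl⟩
      simp
    · intro hy
      exact ⟨⟨y - z, by simpa [dist_eq_norm] using hy⟩, by simp⟩
  have hpre : AffineMap.homothety z r ⁻¹' Metric.sphere z r = Metric.sphere z 1 := by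
    ext y
    simp [AffineMap.homothety_apply, norm_smul, abs_of_pos hr, hr.ne']
  rw [hmap, Measure.restrict_smul, lintegral_smul_measure, smul_eq_mul,
    setLIntegral_map Metric.isClosed_sphere.measurableSet hQ hhom.measurable, hpre, ← hrange,
    ← hiso.map_hausdorffMeasure (Or.inl hd),
    lintegral_map (f := fun y => Q (AffineMap.homothety z r y)) (hQ.comp hhom.measurable)
      hiso.continuous.measurable]
  simp [AffineMap.homothety_apply]

theorem inv_mul_pow_succ_mul_pow_le {a : ENNReal} (ha : a ≠ 0) (ha' : a ≠ ⊤) (b : ENNReal)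
    (d : ℕ) : (a * b)⁻¹ ^ (d + 1) * b ^ d ≤ a⁻¹ ^ (d + 1) * b⁻¹ := by
  rw [ENNReal.mul_inv (Or.inl ha) (Or.inl ha')]
  calc (a⁻¹ * b⁻¹) ^ (d + 1) * b ^ d = a⁻¹ ^ (d + 1) * b⁻¹ * (b⁻¹ * b) ^ d := by ring
    _ ≤ a⁻¹ ^ (d + 1) * b⁻¹ * 1 ^ d := by
        gcongr
        exact ENNReal.inv_mul_le_one b
    _ = _ := by rw [one_pow, mul_one]

/-- Let `n ≥ 2`, `z₀ ∈ ℝⁿ`, `0 < r₁ < r₂`, and let `Q̃ : ℝⁿ → [1, ∞]` be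
Borel measurable. With `ω_{n-1} = H^{n-1}(S^{n-1})` the surface area of the unit sphere,
set `q̃_{z₀}(r) = (1/(ω_{n-1} r^{n-1})) ∫_{S(z₀,r)} Q̃ dH^{n-1}` and
`I = ∫_{r₁}^{r₂} dt / (t · q̃_{z₀}(t)^{1/(n-1)})`, and suppose `0 < I < ∞`. Put
`η₀(t) = 1 / (I · t · q̃_{z₀}(t)^{1/(n-1)})` on `(r₁, r₂)`. Then `∫_{r₁}^{r₂} η₀(t) dt = 1`
and `∫_{A(z₀,r₁,r₂)} Q̃(y) · η₀(|y - z₀|)ⁿ dm(y) ≤ ω_{n-1} / I^{n-1}`. -/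
theorem statement7 {n : ℕ} (hn : 2 ≤ n) (z₀ : EuclideanSpace ℝ (Fin n)) (r₁ r₂ : ℝ)
    (hr₁ : 0 < r₁) (hr₁₂ : r₁ < r₂)
    (Q : EuclideanSpace ℝ (Fin n) → ENNReal) (hQ_meas : Measurable Q)
    (hQ_ge : ∀ y, 1 ≤ Q y)
    (ω : ENNReal)
    (hω : ω = μH[(n : ℝ) - 1] (Metric.sphere (0 : EuclideanSpace ℝ (Fin n)) 1))
    (q : ℝ → ENNReal)
    (hq : ∀ r : ℝ, q r =
      (∫⁻ y in Metric.sphere z₀ r, Q y ∂(μH[(n : ℝ) - 1])) /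
        (ω * ENNReal.ofReal r ^ (n - 1)))
    (I : ENNReal)
    (hI : I = ∫⁻ t in Ioo r₁ r₂, (ENNReal.ofReal t * q t ^ ((1 : ℝ) / ((n : ℝ) - 1)))⁻¹)
    (hI_pos : 0 < I) (hI_fin : I < ⊤)
    (η : ℝ → ENNReal)
    (hη : ∀ t : ℝ, η t = (I * ENNReal.ofReal t * q t ^ ((1 : ℝ) / ((n : ℝ) - 1)))⁻¹) :
    ∫⁻ t in Ioo r₁ r₂, η t = 1 ∧
      ∫⁻ y in {y : EuclideanSpace ℝ (Fin n) | r₁ < dist y z₀ ∧ dist y z₀ < r₂},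
          Q y * η (dist y z₀) ^ n ≤ ω / I ^ (n - 1) := by
  obtain ⟨d, rfl⟩ : ∃ d, n = d + 1 := ⟨n - 1, by lia⟩
  have hd : d ≠ 0 := by lia
  have hdim : ((d + 1 : ℕ) : ℝ) - 1 = d := by simp
  simp only [hdim, Nat.add_sub_cancel] at hω hq hI hη ⊢
  have hI0 : I ≠ 0 := hI_pos.ne'
  have hIt : I ≠ ⊤ := hI_fin.ne
  have hη' (t : ℝ) : η t = I⁻¹ * (ENNReal.ofReal t * q t ^ ((1 : ℝ) / d))⁻¹ := by
    rw [hη, mul_assoc, ENNReal.mul_inv (Or.inl hI0) (Or.inl hIt)]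
  refine ⟨?_, ?_⟩
  · simp_rw [hη']
    rw [lintegral_const_mul' _ _ (ENNReal.inv_ne_top.2 hI0), ← hI, ENNReal.inv_mul_cancel hI0 hIt]
  rcases eq_or_ne ω ⊤ with hωt | hωt
  · rw [hωt, ENNReal.top_div_of_ne_top (ENNReal.pow_ne_top hIt)]
    exact le_top
  let σ := (volume : Measure (EuclideanSpace ℝ (Fin (d + 1)))).toSphere
  have hω' : ω =
      μH[(d : ℝ)] (univ : Set (Metric.sphere (0 : EuclideanSpace ℝ (Fin (d + 1))) 1)) := by
    rw [hω, ← Isometry.hausdorffMeasure_image (f := Subtype.val) isometry_subtype_coe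
      (Or.inl d.cast_nonneg), image_univ, Subtype.range_coe]
  have hω0 : ω ≠ 0 := by
    intro h
    refine (volume : Measure (EuclideanSpace ℝ (Fin (d + 1)))).toSphere_ne_zero
      (Measure.measure_univ_eq_zero.1 ?_)
    refine le_antisymm ((toSphere_le_hausdorffMeasure d univ).trans ?_) zero_le
    rw [← hω', h]
  have hslice {t : ℝ} (ht : 0 < t) :
      ENNReal.ofReal (t ^ d) * ∫⁻ θ, Q (t • θ.1 + z₀) ∂σ ≤ ω * (q t * ENNReal.ofReal t ^ d) := by
    have ht0 : ENNReal.ofReal t ≠ 0 := (ENNReal.ofReal_pos.2 ht).ne'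
    calc _ ≤ ENNReal.ofReal (t ^ d) *
          ∫⁻ θ : Metric.sphere (0 : EuclideanSpace ℝ (Fin (d + 1))) 1,
            Q (t • θ.1 + z₀) ∂μH[(d : ℝ)] := by
          gcongr
          exact toSphere_le_hausdorffMeasure d
      _ = ∫⁻ y in Metric.sphere z₀ t, Q y ∂μH[(d : ℝ)] :=
          (setLIntegral_sphere_hausdorffMeasure d z₀ ht hQ_meas).symm
      _ = q t * (ω * ENNReal.ofReal t ^ d) := by
          rw [hq, ENNReal.div_mul_cancel (mul_ne_zero hω0 (pow_ne_zero _ ht0))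
            (ENNReal.mul_ne_top hωt (ENNReal.pow_ne_top ENNReal.ofReal_ne_top))]
      _ = _ := by ring
  have hpoint (t : ℝ) : η t ^ (d + 1) * (q t * ENNReal.ofReal t ^ d) ≤
      I⁻¹ ^ (d + 1) * (ENNReal.ofReal t * q t ^ ((1 : ℝ) / d))⁻¹ := by
    have hroot : q t = (q t ^ ((1 : ℝ) / d)) ^ d := by
      rw [← ENNReal.rpow_natCast, ← ENNReal.rpow_mul, one_div_mul_cancel (by positivity),
        ENNReal.rpow_one]
    have hqt : q t * ENNReal.ofReal t ^ d = (ENNReal.ofReal t * q t ^ ((1 : ℝ) / d)) ^ d := by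
      rw [mul_pow, ← hroot, mul_comm]
    rw [hη, hqt, mul_assoc]
    exact inv_mul_pow_succ_mul_pow_le hI0 hIt _ d
  set F : EuclideanSpace ℝ (Fin (d + 1)) → ENNReal := {y | r₁ < ‖y‖ ∧ ‖y‖ < r₂}.indicator
    fun y => Q (y + z₀) * η ‖y‖ ^ (d + 1) with hF
  have hmeas : MeasurableSet {y : EuclideanSpace ℝ (Fin (d + 1)) |
      r₁ < dist y z₀ ∧ dist y z₀ < r₂} :=
    measurableSet_Ioo.preimage (f := fun y => dist y z₀) (by fun_prop)
  have hpolar {t : ℝ} (ht : 0 < t) : ENNReal.ofReal (t ^ d) * ∫⁻ θ, F (t • θ.1) ∂σ ≤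
      (Ioo r₁ r₂).indicator
        (fun t => ω * I⁻¹ ^ (d + 1) * (ENNReal.ofReal t * q t ^ ((1 : ℝ) / d))⁻¹) t := by
    have hnorm (θ : Metric.sphere (0 : EuclideanSpace ℝ (Fin (d + 1))) 1) : ‖t • θ.1‖ = t := by
      simp [norm_smul, abs_of_pos ht]
    by_cases h : t ∈ Ioo r₁ r₂
    · have hFt (θ : Metric.sphere (0 : EuclideanSpace ℝ (Fin (d + 1))) 1) :
          F (t • θ.1) = Q (t • θ.1 + z₀) * η t ^ (d + 1) := by
        rw [hF, indicator_of_mem (by simpa only [mem_ofPred_eq, mem_Ioo, hnorm] using h), hnorm]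
      simp_rw [hFt]
      rw [indicator_of_mem h, lintegral_mul_const _ (by fun_prop), ← mul_assoc]
      calc _ ≤ ω * (q t * ENNReal.ofReal t ^ d) * η t ^ (d + 1) :=
            mul_le_mul_left (hslice ht) _
        _ = ω * (η t ^ (d + 1) * (q t * ENNReal.ofReal t ^ d)) := by ring
        _ ≤ _ := by
            rw [mul_assoc]
            exact mul_le_mul_right (hpoint t) _
    · have hFt (θ : Metric.sphere (0 : EuclideanSpace ℝ (Fin (d + 1))) 1) : F (t • θ.1) = 0 := by
        rw [hF, indicator_of_notMem]
        simpa only [mem_ofPred_eq, mem_Ioo, hnorm] using h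
      simp [hFt]
  have hc : ω * I⁻¹ ^ (d + 1) ≠ ⊤ :=
    ENNReal.mul_ne_top hωt (ENNReal.pow_ne_top (ENNReal.inv_ne_top.2 hI0))
  calc _ = ∫⁻ y, F (y - z₀) := by
        rw [← lintegral_indicator hmeas]
        refine lintegral_congr fun y => ?_
        simp [hF, indicator_apply, dist_eq_norm]
    _ = ∫⁻ y, F y := lintegral_sub_right_eq_self F z₀
    _ ≤ ∫⁻ t in Ioi (0 : ℝ), ENNReal.ofReal (t ^ d) * ∫⁻ θ, F (t • θ.1) ∂σ := by
        simpa using lintegral_le_lintegral_toSphere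
          (volume : Measure (EuclideanSpace ℝ (Fin (d + 1)))) F
    _ ≤ ∫⁻ t in Ioi (0 : ℝ), (Ioo r₁ r₂).indicator
          (fun t => ω * I⁻¹ ^ (d + 1) * (ENNReal.ofReal t * q t ^ ((1 : ℝ) / d))⁻¹) t :=
        setLIntegral_mono' measurableSet_Ioi fun t ht => hpolar ht
    _ ≤ ∫⁻ t, (Ioo r₁ r₂).indicator
          (fun t => ω * I⁻¹ ^ (d + 1) * (ENNReal.ofReal t * q t ^ ((1 : ℝ) / d))⁻¹) t :=
        setLIntegral_le_lintegral _ _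
    _ = ω * I⁻¹ ^ (d + 1) * I := by
        rw [lintegral_indicator measurableSet_Ioo, lintegral_const_mul' _ _ hc, ← hI]
    _ = ω / I ^ d := by
        rw [pow_succ, mul_assoc, mul_assoc, ENNReal.inv_mul_cancel hI0 hIt, mul_one,
          ENNReal.div_eq_inv_mul, ENNReal.inv_pow, mul_comm]
end
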